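/- arXiv:1804.01651 — 4 statements merged into one kernel-verified Lean document; each statement's English description precedes it below -/
import Mathlib

section
/- (Sylvester's identity) For complex numbers a and q with |q| < 1, the infinite product (-aq;q)_∞ equals 1 + Σ_{k=1}^∞ a^k q^{(3k²-k)/2} (-aq;q)_{k-1} (1 + a q^{2k}) / (q;q)_k, where the series on the right converges absolutely. -/
/-- The finite q-Pochhammer symbol `(a;q)_n = ∏_{k=0}^{n-1} (1 - a q^k)`. -/
noncomputable def qPoch (a q : ℂ) (n : ℕ) : ℂ := ∏ k ∈ Finset.range n, (1 - a * q ^ k)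

/-- The infinite q-Pochhammer symbol `(a;q)_∞ = ∏_{k=0}^∞ (1 - a q^k)`. -/
noncomputable def qPochInf (a q : ℂ) : ℂ := ∏' k : ℕ, (1 - a * q ^ k)

open Filter Topology

lemma one_sub_pow_succ_norm_ge {q : ℂ} (hq : ‖q‖ < 1) (k : ℕ) : 1 - ‖q‖ ≤ ‖1 - q ^ (k + 1)‖ := by
  have h1 : ‖q‖ ^ (k + 1) ≤ ‖q‖ := pow_le_of_le_one (norm_nonneg q) hq.le k.succ_ne_zero
  have h2 := norm_sub_norm_le (1 : ℂ) (q ^ (k + 1))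
  rw [norm_one, norm_pow] at h2
  linarith

lemma one_sub_pow_succ_ne_zero {q : ℂ} (hq : ‖q‖ < 1) (k : ℕ) : 1 - q ^ (k + 1) ≠ 0 :=
  norm_pos_iff.1 ((sub_pos.2 hq).trans_le (one_sub_pow_succ_norm_ge hq k))

lemma qPoch_succ (a q : ℂ) (n : ℕ) : qPoch a q (n + 1) = qPoch a q n * (1 - a * q ^ n) :=
  Finset.prod_range_succ _ _

lemma qPoch_succ' (a q : ℂ) (n : ℕ) : qPoch a q (n + 1) = (1 - a) * qPoch (a * q) q n := by
  simp only [qPoch, Finset.prod_range_succ', pow_zero, mul_one]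
  rw [mul_comm]
  congr 1
  exact Finset.prod_congr rfl fun k _ => by ring

lemma qPoch_self_succ (q : ℂ) (n : ℕ) : qPoch q q (n + 1) = qPoch q q n * (1 - q ^ (n + 1)) := by
  rw [qPoch_succ, pow_succ']

lemma qPoch_self_norm_ge {q : ℂ} (hq : ‖q‖ < 1) (n : ℕ) : (1 - ‖q‖) ^ n ≤ ‖qPoch q q n‖ := by
  induction n with
  | zero => simp [qPoch]
  | succ n ih =>
    rw [qPoch_self_succ, norm_mul, pow_succ]
    exact mul_le_mul ih (one_sub_pow_succ_norm_ge hq n) (sub_pos.2 hq).le (norm_nonneg _)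

lemma qPoch_norm_le {b q : ℂ} {R : ℝ} (hq : ‖q‖ < 1) (hb : ‖b‖ ≤ R) (n : ℕ) :
    ‖qPoch b q n‖ ≤ (1 + R) ^ n := by
  rw [qPoch, norm_prod]
  refine (Finset.prod_le_prod (g := fun _ => 1 + R) (fun _ _ => norm_nonneg _) fun k _ => ?_).trans_eq
    (by simp)
  refine (norm_sub_le _ _).trans ?_
  rw [norm_one, norm_mul, norm_pow]
  have := mul_le_of_le_one_right (norm_nonneg b) (pow_le_one₀ (n := k) (norm_nonneg q) hq.le)
  linarith

lemma tendsto_qPoch (a : ℂ) {q : ℂ} (hq : ‖q‖ < 1) :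
    Tendsto (qPoch a q) atTop (𝓝 (qPochInf a q)) := by
  have hs : Summable fun k : ℕ => ‖-(a * q ^ k)‖ := by
    simpa [norm_mul, norm_pow] using
      (summable_geometric_of_lt_one (norm_nonneg q) hq).mul_left ‖a‖
  have hm := (multipliable_one_add_of_summable hs).hasProd.tendsto_prod_nat
  simp only [← sub_eq_add_neg] at hm
  exact hm

/-- The pentagonal number `(3 (k + 1) ^ 2 - (k + 1)) / 2`. -/
def sylvesterExponent (k : ℕ) : ℕ := (3 * (k + 1) ^ 2 - (k + 1)) / 2

lemma two_mul_sylvesterExponent (k : ℕ) : 2 * sylvesterExponent k = 3 * k ^ 2 + 5 * k + 2 := by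
  have h : 3 * (k + 1) ^ 2 - (k + 1) = 3 * k ^ 2 + 5 * k + 2 := by
    rw [Nat.sub_eq_iff_eq_add (by nlinarith)]
    ring
  have h2 : 2 ∣ 3 * k ^ 2 + 5 * k + 2 := by
    obtain ⟨m, rfl | rfl⟩ := k.even_or_odd'
    · exact ⟨6 * m ^ 2 + 5 * m + 1, by ring⟩
    · exact ⟨6 * m ^ 2 + 11 * m + 5, by ring⟩
  rw [sylvesterExponent, h, Nat.mul_div_cancel' h2]

lemma sylvesterExponent_succ (k : ℕ) : sylvesterExponent (k + 1) = sylvesterExponent k + (3 * k + 4) := by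
  have h1 := two_mul_sylvesterExponent k
  have h2 := two_mul_sylvesterExponent (k + 1)
  nlinarith

lemma sq_le_sylvesterExponent (k : ℕ) : k * k ≤ sylvesterExponent k := by
  nlinarith [two_mul_sylvesterExponent k]

/-- The telescoping sequence behind Sylvester's identity. -/
noncomputable def sylvesterAux (a q : ℂ) (k : ℕ) : ℂ :=
  a ^ (k + 1) * q ^ sylvesterExponent k * qPoch (-a * q) q k / qPoch q q k

/-- The general term of Sylvester's series. -/
noncomputable def sylvesterTerm (a q : ℂ) (k : ℕ) : ℂ :=
  a ^ (k + 1) * q ^ ((3 * (k + 1) ^ 2 - (k + 1)) / 2) * qPoch (-a * q) q k *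
    (1 + a * q ^ (2 * (k + 1))) / qPoch q q (k + 1)

lemma sylvesterTerm_eq (a q : ℂ) (k : ℕ) :
    sylvesterTerm a q k =
      sylvesterAux a q k * ((1 + a * q ^ (2 * (k + 1))) / (1 - q ^ (k + 1))) := by
  rw [sylvesterTerm, sylvesterAux, qPoch_self_succ, sylvesterExponent, div_mul_div_comm]

lemma sylvesterAux_succ (a q : ℂ) (k : ℕ) :
    sylvesterAux a q (k + 1) = sylvesterAux a q k *
      (a * q ^ (3 * k + 4) * (1 + a * q ^ (k + 1)) / (1 - q ^ (k + 1))) := by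
  rw [sylvesterAux, sylvesterAux, sylvesterExponent_succ, qPoch_self_succ, qPoch_succ, div_mul_div_comm]
  congr 1
  ring

lemma sylvesterAux_mul_right (a q : ℂ) (k : ℕ) :
    (1 + a * q) * sylvesterAux (a * q) q k =
      sylvesterAux a q k * (q ^ (k + 1) * (1 + a * q ^ (k + 1))) := by
  have h : (1 + a * q) * qPoch (-(a * q) * q) q k =
      qPoch (-a * q) q k * (1 + a * q ^ (k + 1)) := by
    have h1 := qPoch_succ' (-a * q) q k
    rw [qPoch_succ] at h1
    rw [neg_mul a q] at h1 ⊢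
    linear_combination -h1
  rw [sylvesterAux, sylvesterAux]
  linear_combination (a * q) ^ (k + 1) * q ^ sylvesterExponent k / qPoch q q k * h

lemma sylvesterTerm_telescope (a : ℂ) {q : ℂ} (hq : ‖q‖ < 1) (k : ℕ) :
    (1 + a * q) * sylvesterTerm (a * q) q k - sylvesterTerm a q k =
      sylvesterAux a q (k + 1) - sylvesterAux a q k := by
  have h := one_sub_pow_succ_ne_zero hq k
  rw [sylvesterTerm_eq, sylvesterTerm_eq, ← mul_assoc, sylvesterAux_mul_right, sylvesterAux_succ]
  field_simp
  ring

lemma sylvester_partial_sum (a : ℂ) {q : ℂ} (hq : ‖q‖ < 1) (n : ℕ) :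
    (1 + a * q) * (1 + ∑ k ∈ Finset.range n, sylvesterTerm (a * q) q k) =
      1 + ∑ k ∈ Finset.range n, sylvesterTerm a q k + sylvesterAux a q n := by
  induction n with
  | zero => simp [sylvesterAux, qPoch, sylvesterExponent]
  | succ n ih =>
    rw [Finset.sum_range_succ, Finset.sum_range_succ]
    linear_combination ih + sylvesterTerm_telescope a hq n

lemma sylvesterAux_norm_le {b q : ℂ} {R : ℝ} (hq : ‖q‖ < 1) (hb : ‖b‖ ≤ R) (k : ℕ) :
    ‖sylvesterAux b q k‖ ≤ R * (R * (1 + R) / (1 - ‖q‖) * ‖q‖ ^ k) ^ k := by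
  have hr : 0 < 1 - ‖q‖ := sub_pos.2 hq
  have hR : 0 ≤ R := (norm_nonneg b).trans hb
  have hbq : ‖-b * q‖ ≤ R := by
    rw [norm_mul, norm_neg]
    exact (mul_le_of_le_one_right (norm_nonneg b) hq.le).trans hb
  rw [sylvesterAux, norm_div, norm_mul, norm_mul, norm_pow, norm_pow]
  calc _ ≤ R ^ (k + 1) * ‖q‖ ^ (k * k) * (1 + R) ^ k / (1 - ‖q‖) ^ k := by
        gcongr ?_ * ?_ * ?_ / ?_
        · gcongr
        · exact pow_le_pow_of_le_one (norm_nonneg q) hq.le (sq_le_sylvesterExponent k)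
        · exact qPoch_norm_le hq hbq k
        · exact qPoch_self_norm_ge hq k
    _ = _ := by
        rw [mul_pow, div_pow, mul_pow, pow_mul]
        ring

lemma sylvesterTerm_norm_le {b q : ℂ} {R : ℝ} (hq : ‖q‖ < 1) (hb : ‖b‖ ≤ R) (k : ℕ) :
    ‖sylvesterTerm b q k‖ ≤
      R * (R * (1 + R) / (1 - ‖q‖) * ‖q‖ ^ k) ^ k * ((1 + R) / (1 - ‖q‖)) := by
  have hr : 0 < 1 - ‖q‖ := sub_pos.2 hq
  have hR : 0 ≤ R := (norm_nonneg b).trans hb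
  rw [sylvesterTerm_eq, norm_mul, norm_div]
  gcongr ?_ * (?_ / ?_)
  · exact sylvesterAux_norm_le hq hb k
  · refine (norm_add_le _ _).trans ?_
    rw [norm_one, norm_mul, norm_pow]
    have := mul_le_of_le_one_right (norm_nonneg b)
      (pow_le_one₀ (n := 2 * (k + 1)) (norm_nonneg q) hq.le)
    linarith
  · exact one_sub_pow_succ_norm_ge hq k

lemma summable_mul_pow_pow {D r : ℝ} (hD : 0 ≤ D) (hr0 : 0 ≤ r) (hr1 : r < 1) :
    Summable fun k : ℕ => (D * r ^ k) ^ k := by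
  have ht : Tendsto (fun k : ℕ => D * r ^ k) atTop (𝓝 0) := by
    simpa using (tendsto_pow_atTop_nhds_zero_of_lt_one hr0 hr1).const_mul D
  refine Summable.of_norm_bounded_eventually_nat summable_geometric_two ?_
  filter_upwards [ht.eventually_le_const (show (0 : ℝ) < 1 / 2 by norm_num)] with k hk
  rw [Real.norm_of_nonneg (by positivity)]
  gcongr

lemma summable_sylvester_bound {q : ℂ} (hq : ‖q‖ < 1) {R : ℝ} (hR : 0 ≤ R) :
    Summable fun k : ℕ => R * (R * (1 + R) / (1 - ‖q‖) * ‖q‖ ^ k) ^ k :=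
  (summable_mul_pow_pow (div_nonneg (by positivity) (sub_pos.2 hq).le) (norm_nonneg q) hq).mul_left R

lemma summable_norm_sylvesterTerm (a : ℂ) {q : ℂ} (hq : ‖q‖ < 1) :
    Summable fun k => ‖sylvesterTerm a q k‖ :=
  Summable.of_nonneg_of_le (fun _ => norm_nonneg _) (sylvesterTerm_norm_le hq le_rfl)
    ((summable_sylvester_bound hq (norm_nonneg a)).mul_right _)

lemma tendsto_sylvesterAux (a : ℂ) {q : ℂ} (hq : ‖q‖ < 1) :
    Tendsto (sylvesterAux a q) atTop (𝓝 0) :=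
  squeeze_zero_norm (sylvesterAux_norm_le hq le_rfl)
    (summable_sylvester_bound hq (norm_nonneg a)).tendsto_atTop_zero

lemma sylvester_tsum_step (a : ℂ) {q : ℂ} (hq : ‖q‖ < 1) :
    1 + ∑' k, sylvesterTerm a q k = (1 + a * q) * (1 + ∑' k, sylvesterTerm (a * q) q k) := by
  have hs (b : ℂ) := (summable_norm_sylvesterTerm b hq).of_norm.hasSum.tendsto_sum_nat
  have h1 := ((hs a).const_add 1).add (tendsto_sylvesterAux a hq)
  have h2 := ((hs (a * q)).const_add 1).const_mul (1 + a * q)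
  rw [add_zero] at h1
  exact tendsto_nhds_unique h1 (h2.congr (sylvester_partial_sum a hq))

lemma sylvester_tsum_iterate (a : ℂ) {q : ℂ} (hq : ‖q‖ < 1) (n : ℕ) :
    1 + ∑' k, sylvesterTerm a q k =
      qPoch (-a * q) q n * (1 + ∑' k, sylvesterTerm (a * q ^ n) q k) := by
  induction n with
  | zero => simp [qPoch]
  | succ n ih =>
    rw [ih, sylvester_tsum_step _ hq, qPoch_succ, pow_succ, ← mul_assoc a]
    ring

lemma tendsto_tsum_sylvesterTerm (a : ℂ) {q : ℂ} (hq : ‖q‖ < 1) :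
    Tendsto (fun n : ℕ => ∑' k, sylvesterTerm (a * q ^ n) q k) atTop (𝓝 0) := by
  have hb : Tendsto (fun n : ℕ => a * q ^ n) atTop (𝓝 0) := by
    simpa using (tendsto_pow_atTop_nhds_zero_of_norm_lt_one hq).const_mul a
  have hterm (k : ℕ) :
      Tendsto (fun n : ℕ => sylvesterTerm (a * q ^ n) q k) atTop (𝓝 (0 : ℂ)) := by
    have hc : Continuous fun b : ℂ => sylvesterTerm b q k := by
      unfold sylvesterTerm qPoch
      fun_prop
    have h0 : sylvesterTerm 0 q k = 0 := by simp [sylvesterTerm]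
    simpa only [h0, Function.comp_def] using (hc.tendsto 0).comp hb
  rw [← tsum_zero (α := ℂ) (β := ℕ)]
  refine tendsto_tsum_of_dominated_convergence
    ((summable_sylvester_bound hq (norm_nonneg a)).mul_right _) hterm
    (Eventually.of_forall fun n k => sylvesterTerm_norm_le hq ?_ k)
  rw [norm_mul, norm_pow]
  exact mul_le_of_le_one_right (norm_nonneg a) (pow_le_one₀ (norm_nonneg q) hq.le)

/-- Sylvester's identity: for `|q| < 1`,
`(-aq;q)_∞ = 1 + Σ_{k=1}^∞ a^k q^{(3k²-k)/2} (-aq;q)_{k-1} (1 + a q^{2k}) / (q;q)_k`,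
the series converging absolutely. -/
theorem sylvester_identity (a q : ℂ) (hq : ‖q‖ < 1) :
    Summable (fun k : ℕ =>
      ‖a ^ (k + 1) * q ^ ((3 * (k + 1) ^ 2 - (k + 1)) / 2) * qPoch (-a * q) q k *
        (1 + a * q ^ (2 * (k + 1))) / qPoch q q (k + 1)‖) ∧
    qPochInf (-a * q) q =
      1 + ∑' k : ℕ, a ^ (k + 1) * q ^ ((3 * (k + 1) ^ 2 - (k + 1)) / 2) * qPoch (-a * q) q k *
        (1 + a * q ^ (2 * (k + 1))) / qPoch q q (k + 1) := by
  refine ⟨summable_norm_sylvesterTerm a hq, ?_⟩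
  have h := (tendsto_qPoch (-a * q) hq).mul ((tendsto_tsum_sylvesterTerm a hq).const_add 1)
  rw [add_zero, mul_one] at h
  exact tendsto_nhds_unique h (tendsto_const_nhds.congr (sylvester_tsum_iterate a hq))
end

section
/- (Euler's pentagonal number theorem) For a complex number q with |q| < 1, the infinite product (q;q)_∞ equals the bilateral sum Σ_{k=-∞}^{∞} (-1)^k q^{(3k²-k)/2}, which converges absolutely. -/
namespace Pentagonal

open Filter Topology

theorem zpow_eq_pow_pentagonal {G : Type*} [DivInvMonoid G] (q : G) (k : ℤ) :
    q ^ ((3 * k ^ 2 - k) / 2) = q ^ pentagonal k := by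
  rw [← zpow_natCast, natCast_pentagonal]
  ring_nf

theorem summable_norm_neg_one_zpow_mul_pow_pentagonal {q : ℂ} (hq : ‖q‖ < 1) :
    Summable fun k : ℤ => ‖(-1 : ℂ) ^ k * q ^ pentagonal k‖ := by
  simpa [Function.comp_def] using
    (summable_geometric_of_lt_one (norm_nonneg q) hq).comp_injective pentagonal_injective

theorem norm_prod_one_sub_pow_le {q : ℂ} (hq : ‖q‖ < 1) (k n : ℕ) :
    ‖∏ i ∈ Finset.range n, (1 - q ^ (k + i + 1))‖ ≤ Real.exp (1 - ‖q‖)⁻¹ := by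
  calc ‖∏ i ∈ Finset.range n, (1 - q ^ (k + i + 1))‖
      ≤ ∏ i ∈ Finset.range n, Real.exp (‖q‖ ^ i) := by
        rw [norm_prod]
        refine Finset.prod_le_prod (fun _ _ => norm_nonneg _) fun i _ => ?_
        calc ‖1 - q ^ (k + i + 1)‖ ≤ 1 + ‖q‖ ^ (k + i + 1) := by
              simpa using norm_sub_le (1 : ℂ) (q ^ (k + i + 1))
          _ ≤ ‖q‖ ^ i + 1 := by
              rw [add_comm]
              gcongr ?_ + 1
              exact pow_le_pow_of_le_one (norm_nonneg q) hq.le (by lia)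
          _ ≤ Real.exp (‖q‖ ^ i) := Real.add_one_le_exp _
    _ = Real.exp (∑ i ∈ Finset.range n, ‖q‖ ^ i) := (Real.exp_sum _ _).symm
    _ ≤ Real.exp (1 - ‖q‖)⁻¹ := by
        rw [← tsum_geometric_of_lt_one (norm_nonneg q) hq]
        gcongr
        exact (summable_geometric_of_lt_one (norm_nonneg q) hq).sum_le_tsum _
          fun _ _ => by positivity

theorem norm_pow_mul_prod_one_sub_pow_le {q : ℂ} (hq : ‖q‖ < 1) (k n : ℕ) :
    ‖q ^ ((k + 1) * n) * ∏ i ∈ Finset.range (n + 1), (1 - q ^ (k + i + 1))‖ ≤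
      ‖q‖ ^ n * Real.exp (1 - ‖q‖)⁻¹ := by
  rw [norm_mul, norm_pow]
  gcongr ?_ * ?_
  · exact pow_le_pow_of_le_one (norm_nonneg q) hq.le (by nlinarith)
  · exact norm_prod_one_sub_pow_le hq k (n + 1)

theorem hasSum_norm_pow_mul_exp {q : ℂ} (hq : ‖q‖ < 1) :
    HasSum (fun n : ℕ => ‖q‖ ^ n * Real.exp (1 - ‖q‖)⁻¹)
      ((1 - ‖q‖)⁻¹ * Real.exp (1 - ‖q‖)⁻¹) :=
  (hasSum_geometric_of_lt_one (norm_nonneg q) hq).mul_right _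

theorem multipliable_one_sub_pow {q : ℂ} (hq : ‖q‖ < 1) (k : ℕ) :
    Multipliable fun n : ℕ => 1 - q ^ (n + k + 1) := by
  simp_rw [sub_eq_add_neg]
  apply multipliable_one_add_of_summable
  simpa [add_assoc] using
    (summable_nat_add_iff (k + 1)).2 (summable_geometric_of_lt_one (norm_nonneg q) hq)

theorem tendsto_pow_mul_tsum_zero {q : ℂ} (hq : ‖q‖ < 1) :
    Tendsto (fun k : ℕ => (-1) ^ (k + 1) * q ^ ((k + 1) * (3 * k + 4) / 2) *
      ∑' n : ℕ, q ^ ((k + 1) * n) * ∏ i ∈ Finset.range (n + 1), (1 - q ^ (k + i + 1)))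
      atTop (𝓝 0) := by
  have h := (tendsto_pow_atTop_nhds_zero_of_lt_one (norm_nonneg q) hq).mul_const
    ((1 - ‖q‖)⁻¹ * Real.exp (1 - ‖q‖)⁻¹)
  rw [zero_mul] at h
  refine squeeze_zero_norm (fun k => ?_) h
  rw [norm_mul, norm_mul, norm_pow, norm_pow, norm_neg, norm_one, one_pow, one_mul]
  gcongr ?_ * ?_
  · refine pow_le_pow_of_le_one (norm_nonneg q) hq.le ?_
    rw [Nat.le_div_iff_mul_le two_pos]
    nlinarith
  · exact tsum_of_norm_bounded (hasSum_norm_pow_mul_exp hq)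
      (norm_pow_mul_prod_one_sub_pow_le hq k)

theorem hasSum_pow_pentagonal_sub {q : ℂ} (hq : ‖q‖ < 1) :
    HasSum (fun k : ℕ => (-1) ^ k * (q ^ pentagonal (-k) - q ^ pentagonal (k + 1)))
      (∑' k : ℤ, (-1 : ℂ) ^ k * q ^ pentagonal k) := by
  have h := (summable_norm_neg_one_zpow_mul_pow_pentagonal hq).of_norm.hasSum
  rw [← (Equiv.neg ℤ).hasSum_iff] at h
  refine h.nat_add_neg_add_one.congr_fun fun k => ?_
  have hk : (-1 : ℂ) ^ ((k : ℤ) + 1) = -(-1) ^ k := by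
    exact_mod_cast (pow_succ (-1 : ℂ) k).trans (mul_neg_one _)
  simp only [Function.comp_apply, Equiv.neg_apply, neg_neg, hk, zpow_neg, zpow_natCast,
    ← inv_pow, inv_neg_one]
  ring

end Pentagonal

/-- Euler's pentagonal number theorem: for `|q| < 1`,
`(q;q)_∞ = ∏_{k=1}^∞ (1 - q^k) = Σ_{k=-∞}^∞ (-1)^k q^{(3k²-k)/2}`,
the bilateral series converging absolutely. -/
theorem pentagonal_number_theorem (q : ℂ) (hq : ‖q‖ < 1) :
    Summable (fun k : ℤ => ‖(-1 : ℂ) ^ k * q ^ ((3 * k ^ 2 - k) / 2)‖) ∧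
    (∏' k : ℕ, (1 - q ^ (k + 1))) = ∑' k : ℤ, (-1 : ℂ) ^ k * q ^ ((3 * k ^ 2 - k) / 2) := by
  simp_rw [Pentagonal.zpow_eq_pow_pentagonal]
  have h := Pentagonal.hasSum_pow_pentagonal_sub hq
  refine ⟨Pentagonal.summable_norm_neg_one_zpow_mul_pow_pentagonal hq, ?_⟩
  rw [← h.tsum_eq]
  exact Pentagonal.tprod_one_sub_pow (tendsto_pow_atTop_nhds_zero_of_norm_lt_one hq)
    (fun k => .of_norm_bounded (Pentagonal.hasSum_norm_pow_mul_exp hq).summable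
      (Pentagonal.norm_pow_mul_prod_one_sub_pow_le hq k))
    (Pentagonal.multipliable_one_sub_pow hq) h.summable (Pentagonal.tendsto_pow_mul_tsum_zero hq)
end

section
/- (Gauss) For a complex number q with |q| < 1, the quotient (q²;q²)_∞ / (-q;q²)_∞ equals the bilateral theta sum Σ_{k=-∞}^{∞} (-1)^k q^{2k²-k}, which converges absolutely. -/
open Filter Topology

/-- The partial product `∏_{s=1}^n (1 - x^{2s}) / (1 - x^{2s-1})`. -/
def shanksProd {K : Type*} [Field K] (x : K) (n : ℕ) : K :=
  ∏ s ∈ Finset.range n, (1 - x ^ (2 * s + 2)) / (1 - x ^ (2 * s + 1))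

/-- The terms on the left side of Shanks's identity. -/
def shanksTerm {K : Type*} [Field K] (x : K) (n s : ℕ) : K :=
  shanksProd x n / shanksProd x s * x ^ (s * (2 * n + 1))

section Shanks

variable {K : Type*} [Field K] {x : K}

lemma shanksProd_succ (x : K) (n : ℕ) :
    shanksProd x (n + 1) = shanksProd x n * ((1 - x ^ (2 * n + 2)) / (1 - x ^ (2 * n + 1))) :=
  Finset.prod_range_succ _ _

lemma shanksProd_ne_zero (hx : ∀ m : ℕ, 1 - x ^ (m + 1) ≠ 0) (n : ℕ) : shanksProd x n ≠ 0 :=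
  Finset.prod_ne_zero_iff.2 fun s _ => div_ne_zero (hx (2 * s + 1)) (hx (2 * s))

lemma sum_shanksTerm_succ_sub (hx : ∀ m : ℕ, 1 - x ^ (m + 1) ≠ 0) (n m : ℕ) :
    ∑ s ∈ Finset.range m, (shanksTerm x (n + 1) s - shanksTerm x n s) =
      shanksProd x n / shanksProd x m * (1 - x ^ (2 * m)) * x ^ (m * (2 * n + 1)) /
        (1 - x ^ (2 * n + 1)) := by
  induction m with
  | zero => simp
  | succ m ih =>
    have h₁ := hx (2 * n)
    have h₂ := hx (2 * m)
    have h₃ := hx (2 * m + 1)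
    have h₄ := shanksProd_ne_zero hx m
    rw [Finset.sum_range_succ, ih, shanksTerm, shanksTerm, shanksProd_succ, shanksProd_succ]
    rw [show 2 * m + 1 + 1 = 2 * m + 2 by ring] at h₃
    rw [show m * (2 * (n + 1) + 1) = m * (2 * n + 1) + 2 * m by ring,
      show 2 * (m + 1) = 2 * m + 2 by ring,
      show (m + 1) * (2 * n + 1) = m * (2 * n + 1) + (2 * n + 1) by ring]
    field_simp
    ring

/-- **Shanks's identity**, a finite form of Gauss's theorem on triangular exponents. -/
lemma sum_shanksTerm (hx : ∀ m : ℕ, 1 - x ^ (m + 1) ≠ 0) (n : ℕ) :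
    ∑ s ∈ Finset.range n, shanksTerm x n s =
      ∑ k ∈ Finset.range n, (x ^ (k * (2 * k + 1)) + x ^ ((k + 1) * (2 * k + 1))) := by
  induction n with
  | zero => simp
  | succ n ih =>
    have h := sum_shanksTerm_succ_sub hx n n
    rw [Finset.sum_sub_distrib, sub_eq_iff_eq_add, ih] at h
    rw [Finset.sum_range_succ, h, Finset.sum_range_succ, shanksTerm, shanksProd_succ]
    have h₁ := hx (2 * n)
    have h₄ := shanksProd_ne_zero hx n
    rw [show n * (2 * (n + 1) + 1) = n * (2 * n + 1) + 2 * n by ring,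
      show (n + 1) * (2 * n + 1) = n * (2 * n + 1) + (2 * n + 1) by ring]
    field_simp
    ring

end Shanks

lemma one_sub_pow_succ_ne_zero_s3 {x : ℂ} (hx : ‖x‖ < 1) (m : ℕ) : 1 - x ^ (m + 1) ≠ 0 := by
  intro h
  have h' : ‖x ^ (m + 1)‖ = 1 := by rw [← sub_eq_zero.1 h, norm_one]
  rw [norm_pow] at h'
  exact (pow_lt_one₀ (norm_nonneg x) hx m.succ_ne_zero).ne h'

lemma summable_norm_neg_mul_pow (a : ℂ) {q : ℂ} (hq : ‖q‖ < 1) :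
    Summable fun k : ℕ => ‖-(a * q ^ k)‖ := by
  simpa using (summable_geometric_of_lt_one (norm_nonneg q) hq).mul_left ‖a‖

lemma tendsto_prod_qPochInf (a : ℂ) {q : ℂ} (hq : ‖q‖ < 1) :
    Tendsto (fun n => ∏ k ∈ Finset.range n, (1 - a * q ^ k)) atTop (𝓝 (qPochInf a q)) := by
  have h := multipliable_one_add_of_summable (summable_norm_neg_mul_pow a hq)
  simp only [← sub_eq_add_neg] at h
  exact h.hasProd.tendsto_prod_nat

lemma qPochInf_ne_zero {a q : ℂ} (hq : ‖q‖ < 1) (ha : ∀ k : ℕ, 1 - a * q ^ k ≠ 0) :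
    qPochInf a q ≠ 0 := by
  have h := tprod_one_add_ne_zero_of_summable (f := fun k : ℕ => -(a * q ^ k))
    (by simpa only [← sub_eq_add_neg] using ha) (summable_norm_neg_mul_pow a hq)
  simpa only [qPochInf, sub_eq_add_neg] using h

lemma qPochInf_sq_ne_zero {x : ℂ} (hx : ‖x‖ < 1) (m : ℕ) :
    qPochInf (x ^ (m + 1)) (x ^ 2) ≠ 0 := by
  refine qPochInf_ne_zero ?_ fun k => ?_
  · rw [norm_pow]
    exact pow_lt_one₀ (norm_nonneg x) hx two_ne_zero
  · rw [← pow_mul, ← pow_add, show m + 1 + 2 * k = m + 2 * k + 1 by ring]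
    exact one_sub_pow_succ_ne_zero_s3 hx _

lemma tendsto_shanksProd {x : ℂ} (hx : ‖x‖ < 1) :
    Tendsto (shanksProd x) atTop (𝓝 (qPochInf (x ^ 2) (x ^ 2) / qPochInf x (x ^ 2))) := by
  have hx2 : ‖x ^ 2‖ < 1 := by
    rw [norm_pow]
    exact pow_lt_one₀ (norm_nonneg x) hx two_ne_zero
  have h0 : qPochInf x (x ^ 2) ≠ 0 := by simpa using qPochInf_sq_ne_zero hx 0
  refine ((tendsto_prod_qPochInf (x ^ 2) hx2).div (tendsto_prod_qPochInf x hx2) h0).congr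
    fun n => ?_
  rw [Pi.div_apply, ← Finset.prod_div_distrib]
  refine Finset.prod_congr rfl fun s _ => ?_
  ring

lemma exists_norm_shanksProd_div_le {x : ℂ} (hx : ‖x‖ < 1) :
    ∃ C : ℝ, ∀ n s, ‖shanksProd x n / shanksProd x s‖ ≤ C := by
  have hP := tendsto_shanksProd hx
  have h0 : qPochInf x (x ^ 2) ≠ 0 := by simpa using qPochInf_sq_ne_zero hx 0
  have hQ := hP.inv₀ (div_ne_zero (qPochInf_sq_ne_zero hx 1) h0)
  obtain ⟨A, hA⟩ := (Metric.isBounded_range_of_tendsto _ hP).exists_norm_le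
  obtain ⟨B, hB⟩ := (Metric.isBounded_range_of_tendsto _ hQ).exists_norm_le
  refine ⟨A * B, fun n s => ?_⟩
  have hAn := hA _ ⟨n, rfl⟩
  rw [div_eq_mul_inv, norm_mul]
  exact mul_le_mul hAn (hB _ ⟨s, rfl⟩) (norm_nonneg _) ((norm_nonneg _).trans hAn)

lemma tendsto_sum_shanksTerm {x : ℂ} (hx : ‖x‖ < 1) :
    Tendsto (fun n => ∑ s ∈ Finset.range n, shanksTerm x n s) atTop
      (𝓝 (qPochInf (x ^ 2) (x ^ 2) / qPochInf x (x ^ 2))) := by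
  obtain ⟨C, hC⟩ := exists_norm_shanksProd_div_le hx
  have hC0 : 0 ≤ C := (norm_nonneg _).trans (hC 0 0)
  rw [← tendsto_add_atTop_iff_nat 1]
  have hrem : Tendsto (fun n => ∑ s ∈ Finset.range n, shanksTerm x (n + 1) (s + 1)) atTop
      (𝓝 0) := by
    refine squeeze_zero_norm (a := fun n : ℕ => C * (n * ‖x‖ ^ n)) (fun n => ?_) ?_
    · refine (norm_sum_le_of_le (Finset.range n) (f := _) (n := fun _ => C * ‖x‖ ^ n)
        fun s _ => ?_).trans (le_of_eq ?_)
      · rw [shanksTerm, norm_mul, norm_pow]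
        refine mul_le_mul (hC _ _) ?_ (by positivity) hC0
        exact pow_le_pow_of_le_one (norm_nonneg x) hx.le (by nlinarith)
      · simp
        ring
    · simpa using (tendsto_self_mul_const_pow_of_lt_one (norm_nonneg x) hx).const_mul C
  have h := hrem.add ((tendsto_add_atTop_iff_nat 1).2 (tendsto_shanksProd hx))
  rw [zero_add] at h
  refine h.congr fun n => ?_
  rw [Finset.sum_range_succ']
  simp [shanksTerm, shanksProd]

lemma neg_one_zpow_mul_zpow_neg_natCast (q : ℂ) (n : ℕ) :
    (-1 : ℂ) ^ (-(n : ℤ)) * q ^ (2 * (-(n : ℤ)) ^ 2 - -(n : ℤ)) = (-q) ^ (n * (2 * n + 1)) := by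
  rw [show 2 * (-(n : ℤ)) ^ 2 - -(n : ℤ) = ((n * (2 * n + 1) : ℕ) : ℤ) by push_cast; ring,
    zpow_natCast, neg_pow q, zpow_neg, zpow_natCast, ← inv_pow, inv_neg, inv_one,
    show n * (2 * n + 1) = 2 * n ^ 2 + n by ring, pow_add (-1 : ℂ), pow_mul (-1 : ℂ)]
  simp

lemma neg_one_zpow_mul_zpow_natCast_add_one (q : ℂ) (n : ℕ) :
    (-1 : ℂ) ^ ((n : ℤ) + 1) * q ^ (2 * ((n : ℤ) + 1) ^ 2 - ((n : ℤ) + 1)) =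
      (-q) ^ ((n + 1) * (2 * n + 1)) := by
  rw [show 2 * ((n : ℤ) + 1) ^ 2 - ((n : ℤ) + 1) = (((n + 1) * (2 * n + 1) : ℕ) : ℤ) by
      push_cast; ring, ← Nat.cast_succ,
    zpow_natCast, neg_pow q, zpow_natCast,
    show (n + 1) * (2 * n + 1) = 2 * (n ^ 2 + n) + (n + 1) by ring, pow_add (-1 : ℂ),
    pow_mul (-1 : ℂ)]
  simp

/-- Gauss: for `|q| < 1`, `(q²;q²)_∞ / (-q;q²)_∞ = Σ_{k=-∞}^∞ (-1)^k q^{2k²-k}`,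
the bilateral series converging absolutely. -/
theorem gauss_theta4 (q : ℂ) (hq : ‖q‖ < 1) :
    Summable (fun k : ℤ => ‖(-1 : ℂ) ^ k * q ^ (2 * k ^ 2 - k)‖) ∧
    qPochInf (q ^ 2) (q ^ 2) / qPochInf (-q) (q ^ 2) =
      ∑' k : ℤ, (-1 : ℂ) ^ k * q ^ (2 * k ^ 2 - k) := by
  have hx : ‖-q‖ < 1 := by rwa [norm_neg]
  have hgeom := summable_geometric_of_lt_one (norm_nonneg (-q)) hx
  have h₁ : Summable fun n : ℕ => ‖(-q) ^ (n * (2 * n + 1))‖ :=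
    hgeom.of_nonneg_of_le (fun _ => norm_nonneg _) fun n => by
      rw [norm_pow]
      exact pow_le_pow_of_le_one (norm_nonneg _) hx.le (by nlinarith)
  have h₂ : Summable fun n : ℕ => ‖(-q) ^ ((n + 1) * (2 * n + 1))‖ :=
    hgeom.of_nonneg_of_le (fun _ => norm_nonneg _) fun n => by
      rw [norm_pow]
      exact pow_le_pow_of_le_one (norm_nonneg _) hx.le (by nlinarith)
  constructor
  · rw [← (Equiv.neg ℤ).summable_iff]
    refine Summable.of_nat_of_neg_add_one ?_ ?_
    · simpa only [Function.comp_apply, Equiv.neg_apply, neg_one_zpow_mul_zpow_neg_natCast] using h₁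
    · simpa only [Function.comp_apply, Equiv.neg_apply, neg_neg,
        neg_one_zpow_mul_zpow_natCast_add_one] using h₂
  · have hsum : HasSum (fun k : ℤ => (-1 : ℂ) ^ k * q ^ (2 * k ^ 2 - k))
        (∑' n : ℕ, (-q) ^ (n * (2 * n + 1)) + ∑' n : ℕ, (-q) ^ ((n + 1) * (2 * n + 1))) := by
      rw [← (Equiv.neg ℤ).hasSum_iff]
      refine HasSum.of_nat_of_neg_add_one ?_ ?_
      · simpa only [Function.comp_apply, Equiv.neg_apply, neg_one_zpow_mul_zpow_neg_natCast]
          using h₁.of_norm.hasSum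
      · simpa only [Function.comp_apply, Equiv.neg_apply, neg_neg,
          neg_one_zpow_mul_zpow_natCast_add_one] using h₂.of_norm.hasSum
    rw [hsum.tsum_eq]
    have hlim := (h₁.of_norm.hasSum.add h₂.of_norm.hasSum).tendsto_sum_nat
    simp only [← sum_shanksTerm (one_sub_pow_succ_ne_zero_s3 hx)] at hlim
    have hgauss := tendsto_sum_shanksTerm hx
    rw [neg_sq] at hgauss
    exact tendsto_nhds_unique hgauss hlim
end

section
/- (Cauchy's identity) Let q ∈ ℂ with 0 < |q| < 1 and let a ∈ ℂ with |a| < 1. Then 1/(aq;q)_∞ = 1 + Σ_{N=1}^∞ a^N q^{N²} / [(q;q)_N (aq;q)_N], where the series converges absolutely and all denominators are nonzero. -/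
open Filter Topology

/-- A lower bound for `|(aq;q)_n|`, uniform in `n` and in `|a| ≤ 1`. -/
lemma exists_pos_le_norm_qPoch {q : ℂ} (hq : ‖q‖ < 1) :
    ∃ c > 0, ∀ a : ℂ, ‖a‖ ≤ 1 → ∀ n, c ≤ ‖qPoch (a * q) q n‖ := by
  set r := ‖q‖
  have hr0 : 0 ≤ r := norm_nonneg q
  have hfac (k : ℕ) : 0 < 1 - r ^ (k + 1) := sub_pos.2 (pow_lt_one₀ hr0 hq k.succ_ne_zero)
  have hs : Summable fun k : ℕ => ‖-r ^ (k + 1)‖ := by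
    simpa [abs_of_nonneg hr0] using
      (summable_nat_add_iff 1).2 (summable_geometric_of_lt_one hr0 hq)
  have hlim := (multipliable_one_add_of_summable hs).hasProd.tendsto_prod_nat
  have hne := tprod_one_add_ne_zero_of_summable
    (f := fun k : ℕ => -r ^ (k + 1)) (fun k => by simpa [← sub_eq_add_neg] using (hfac k).ne') hs
  simp only [← sub_eq_add_neg] at hlim hne
  have hanti : Antitone fun n => ∏ k ∈ Finset.range n, (1 - r ^ (k + 1)) := by
    refine antitone_nat_of_succ_le fun n => ?_
    rw [Finset.prod_range_succ]
    refine mul_le_of_le_one_right (Finset.prod_nonneg fun k _ => (hfac k).le) ?_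
    linarith [pow_nonneg hr0 (n + 1)]
  refine ⟨∏' k : ℕ, (1 - r ^ (k + 1)), lt_of_le_of_ne
    (ge_of_tendsto' hlim fun n => Finset.prod_nonneg fun k _ => (hfac k).le) hne.symm,
    fun a ha n => (hanti.le_of_tendsto hlim n).trans ?_⟩
  rw [qPoch, norm_prod]
  refine Finset.prod_le_prod (fun k _ => (hfac k).le) fun k _ => ?_
  have h1 : ‖a * q * q ^ k‖ ≤ r ^ (k + 1) := by
    rw [mul_assoc, ← pow_succ', norm_mul, norm_pow]
    exact mul_le_of_le_one_left (pow_nonneg hr0 _) ha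
  have h2 := norm_sub_norm_le (1 : ℂ) (a * q * q ^ k)
  rw [norm_one] at h2
  linarith

/-- The `n`-th term `a^n q^{n²} / ((q;q)_n (aq;q)_n)` of the series in Cauchy's identity. -/
noncomputable def cauchyTerm (q a : ℂ) (n : ℕ) : ℂ :=
  a ^ n * q ^ (n ^ 2) / (qPoch q q n * qPoch (a * q) q n)

lemma exists_norm_div_qPoch_le {q : ℂ} (hq : ‖q‖ < 1) :
    ∃ C, ∀ a b : ℂ, ‖b‖ ≤ 1 → ∀ i j k l : ℕ,
      ‖a ^ i * q ^ j / (qPoch q q k * qPoch (b * q) q l)‖ ≤ ‖a‖ ^ i * C := by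
  obtain ⟨c, hc, h⟩ := exists_pos_le_norm_qPoch hq
  refine ⟨(c * c)⁻¹, fun a b hb i j k l => ?_⟩
  have h1 : c ≤ ‖qPoch q q k‖ := by simpa using h 1 (by simp) k
  rw [div_eq_mul_inv, norm_mul, norm_mul, norm_inv, norm_mul, norm_pow, norm_pow]
  have h2 := h b hb l
  gcongr
  exact mul_le_of_le_one_right (by positivity) (pow_le_one₀ (norm_nonneg q) hq.le)

lemma qPoch_ne_zero {q a : ℂ} (hq : ‖q‖ < 1) (ha : ‖a‖ ≤ 1) (n : ℕ) :
    qPoch (a * q) q n ≠ 0 := by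
  obtain ⟨c, hc, h⟩ := exists_pos_le_norm_qPoch hq
  exact norm_pos_iff.1 (hc.trans_le (h a ha n))

lemma qPoch_self_ne_zero {q : ℂ} (hq : ‖q‖ < 1) (n : ℕ) : qPoch q q n ≠ 0 := by
  simpa using qPoch_ne_zero (a := 1) hq (by simp) n

lemma summable_norm_cauchyTerm {q a : ℂ} (hq : ‖q‖ < 1) (ha : ‖a‖ < 1) :
    Summable fun n => ‖cauchyTerm q a n‖ := by
  obtain ⟨C, hC⟩ := exists_norm_div_qPoch_le hq
  exact Summable.of_nonneg_of_le (fun _ => norm_nonneg _) (fun n => hC a a ha.le n _ n n)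
    ((summable_geometric_of_lt_one (norm_nonneg a) ha).mul_right C)

lemma norm_mul_lt_one {q a : ℂ} (hq : ‖q‖ < 1) (ha : ‖a‖ < 1) : ‖a * q‖ < 1 := by
  rw [norm_mul]
  exact mul_lt_one_of_nonneg_of_lt_one_left (norm_nonneg a) ha hq.le

lemma one_sub_mul_cauchyTerm {q a : ℂ} (hq : ‖q‖ < 1) (ha : ‖a‖ < 1) (n : ℕ) :
    (1 - a * q) * cauchyTerm q a n =
      a ^ n * q ^ (n ^ 2) * (1 - a * q * q ^ n) / (qPoch q q n * qPoch (a * q * q) q n) := by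
  have h1 := qPoch_self_ne_zero hq n
  have h2 := qPoch_ne_zero hq ha.le n
  have h3 := qPoch_ne_zero hq (norm_mul_lt_one hq ha).le n
  have h4 := (qPoch_succ (a * q) q n).symm.trans (qPoch_succ' (a * q) q n)
  rw [cauchyTerm, ← mul_div_assoc, div_eq_div_iff (mul_ne_zero h1 h2) (mul_ne_zero h1 h3)]
  linear_combination -(a ^ n * q ^ (n ^ 2) * qPoch q q n) * h4

lemma sum_cauchyTerm_sub {q a : ℂ} (hq : ‖q‖ < 1) (ha : ‖a‖ < 1) (n : ℕ) :
    ∑ k ∈ Finset.range (n + 1), ((1 - a * q) * cauchyTerm q a k - cauchyTerm q (a * q) k) =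
      -(a ^ (n + 1) * q ^ ((n + 1) ^ 2) / (qPoch q q n * qPoch (a * q * q) q n)) := by
  induction n with
  | zero => simp [cauchyTerm, qPoch]
  | succ n ih =>
    rw [Finset.sum_range_succ, ih, one_sub_mul_cauchyTerm hq ha, cauchyTerm]
    have h1 := qPoch_self_ne_zero hq (n + 1)
    have h2 := qPoch_ne_zero hq (norm_mul_lt_one hq ha).le (n + 1)
    rw [qPoch_succ] at h1 h2
    have h3 := mul_ne_zero (right_ne_zero_of_mul h1) (right_ne_zero_of_mul h2)
    rw [← mul_div_mul_right _ (qPoch q q n * qPoch (a * q * q) q n) h3, mul_mul_mul_comm (qPoch q q n),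
      ← qPoch_succ, ← qPoch_succ, ← sub_div, ← neg_div, ← add_div, ← neg_div]
    congr 1
    ring

/-- The functional equation `(1 - aq) F(a) = F(aq)` of the series in Cauchy's identity. -/
lemma one_sub_mul_tsum_cauchyTerm {q a : ℂ} (hq : ‖q‖ < 1) (ha : ‖a‖ < 1) :
    (1 - a * q) * ∑' n, cauchyTerm q a n = ∑' n, cauchyTerm q (a * q) n := by
  have haq := norm_mul_lt_one hq ha
  have hsum := ((summable_norm_cauchyTerm hq ha).of_norm.hasSum.mul_left (1 - a * q)).sub
    (summable_norm_cauchyTerm hq haq).of_norm.hasSum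
  have hlim := (tendsto_add_atTop_iff_nat 1).2 hsum.tendsto_sum_nat
  simp only [sum_cauchyTerm_sub hq ha] at hlim
  obtain ⟨C, hC⟩ := exists_norm_div_qPoch_le hq
  have hzero : Tendsto (fun n : ℕ =>
      -(a ^ (n + 1) * q ^ ((n + 1) ^ 2) / (qPoch q q n * qPoch (a * q * q) q n))) atTop (𝓝 0) := by
    refine squeeze_zero_norm (a := fun n : ℕ => ‖a‖ ^ (n + 1) * C) (fun n => ?_) ?_
    · rw [norm_neg]
      exact hC a (a * q) haq.le _ _ _ _
    · simpa using ((tendsto_add_atTop_iff_nat 1).2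
        (tendsto_pow_atTop_nhds_zero_of_lt_one (norm_nonneg a) ha)).mul_const C
  exact sub_eq_zero.1 (tendsto_nhds_unique hlim hzero)

lemma norm_mul_pow_le {q a : ℂ} (hq : ‖q‖ < 1) (n : ℕ) : ‖a * q ^ n‖ ≤ ‖a‖ := by
  rw [norm_mul, norm_pow]
  exact mul_le_of_le_one_right (norm_nonneg a) (pow_le_one₀ (norm_nonneg q) hq.le)

lemma qPoch_mul_tsum_cauchyTerm {q a : ℂ} (hq : ‖q‖ < 1) (ha : ‖a‖ < 1) (n : ℕ) :
    qPoch (a * q) q n * ∑' k, cauchyTerm q a k = ∑' k, cauchyTerm q (a * q ^ n) k := by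
  induction n with
  | zero => simp [qPoch]
  | succ n ih =>
    have h := one_sub_mul_tsum_cauchyTerm hq ((norm_mul_pow_le hq n).trans_lt ha)
    rw [← ih, mul_assoc a, ← pow_succ] at h
    rw [← h, qPoch_succ]
    ring

lemma tendsto_tsum_cauchyTerm {q a : ℂ} (hq : ‖q‖ < 1) (ha : ‖a‖ < 1) :
    Tendsto (fun n : ℕ => ∑' k, cauchyTerm q (a * q ^ n) k) atTop (𝓝 1) := by
  obtain ⟨C, hC⟩ := exists_norm_div_qPoch_le hq
  have hC0 : 0 ≤ C := by simpa using (norm_nonneg _).trans (hC 1 0 (by simp) 0 0 0 0)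
  have hle (n : ℕ) : ‖a * q ^ n‖ ≤ ‖a‖ := norm_mul_pow_le hq n
  have hb : Tendsto (fun n : ℕ => ‖a * q ^ n‖) atTop (𝓝 0) := by
    simpa using ((tendsto_pow_atTop_nhds_zero_of_norm_lt_one hq).const_mul a).norm
  have h := tendsto_tsum_of_dominated_convergence (𝓕 := atTop)
    (f := fun n k => cauchyTerm q (a * q ^ n) k) (g := fun k => if k = 0 then (1 : ℂ) else 0)
    (bound := fun k => ‖a‖ ^ k * C)
    ((summable_geometric_of_lt_one (norm_nonneg a) ha).mul_right C) ?_ ?_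
  · simpa using h
  · intro k
    rcases eq_or_ne k 0 with rfl | hk
    · simp [cauchyTerm, qPoch]
    · rw [if_neg hk]
      refine squeeze_zero_norm (fun n => hC _ _ ((hle n).trans ha.le) k _ k k) ?_
      simpa [hk] using (hb.pow k).mul_const C
  · refine Eventually.of_forall fun n k => (hC _ _ ((hle n).trans ha.le) k _ k k).trans ?_
    gcongr
    exact hle n

/-- Cauchy's identity: for `0 < |q| < 1` and `|a| < 1`,
`1/(aq;q)_∞ = 1 + Σ_{N=1}^∞ a^N q^{N²} / ((q;q)_N (aq;q)_N)`,
the series converging absolutely, with all denominators nonzero. -/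
theorem cauchy_identity (q a : ℂ) (hq0 : 0 < ‖q‖) (hq : ‖q‖ < 1) (ha : ‖a‖ < 1) :
    (∀ N : ℕ, qPoch q q N ≠ 0 ∧ qPoch (a * q) q N ≠ 0) ∧
    Summable (fun N : ℕ =>
      ‖a ^ (N + 1) * q ^ ((N + 1) ^ 2) / (qPoch q q (N + 1) * qPoch (a * q) q (N + 1))‖) ∧
    1 / qPochInf (a * q) q =
      1 + ∑' N : ℕ, a ^ (N + 1) * q ^ ((N + 1) ^ 2) /
        (qPoch q q (N + 1) * qPoch (a * q) q (N + 1)) := by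
  refine ⟨fun N => ⟨qPoch_self_ne_zero hq N, qPoch_ne_zero hq ha.le N⟩,
    (summable_nat_add_iff 1).2 (summable_norm_cauchyTerm hq ha), ?_⟩
  have hprod := tendsto_nhds_unique
    (((tendsto_qPoch (a * q) hq).mul_const _).congr (qPoch_mul_tsum_cauchyTerm hq ha))
    (tendsto_tsum_cauchyTerm hq ha)
  have hsplit := (summable_norm_cauchyTerm hq ha).of_norm.tsum_eq_zero_add
  rw [one_div, inv_eq_of_mul_eq_one_right hprod, hsplit]
  simp [cauchyTerm, qPoch]
end
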